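/- arXiv:2605.22669 — 2 statements merged into one kernel-verified Lean document; each statement's English description precedes it below -/
import Mathlib

section
/- Let x ∈ G, let χ be an irreducible complex character of G with χ(x) ≠ 0, and let N ⊴ G. Then there exists an irreducible constituent θ of the restriction χ_N that is invariant under conjugation by x, and if ψ ∈ Irr(G_θ) is the Clifford correspondent of χ over θ (so ψ^G = χ), then ψ(x) ≠ 0. -/
attribute [local instance] Classical.propDecidable

/-- The usual inner product of class functions/characters on a finite group. -/
noncomputable def innerChar (G : Type*) [Group G] [Fintype G] (α β : G → ℂ) : ℂ :=
  (Fintype.card G : ℂ)⁻¹ * ∑ g : G, α g * (starRingEnd ℂ) (β g)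

/-- `χ : G → ℂ` is the character of some finite-dimensional complex representation. -/
def IsChar (G : Type) [Group G] [Fintype G] (χ : G → ℂ) : Prop :=
  ∃ V : FDRep ℂ G, FDRep.character V = χ

/-- `χ` is an irreducible complex character of `G`. -/
def IsIrrChar (G : Type) [Group G] [Fintype G] (χ : G → ℂ) : Prop :=
  IsChar G χ ∧ innerChar G χ χ = 1

/-- The induced character `ψ^G` of a character `ψ` of a subgroup `H ≤ G`. -/
noncomputable def indChar {G : Type*} [Group G] [Fintype G] (H : Subgroup G)
    (ψ : ↥H → ℂ) : G → ℂ := fun g =>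
  (Fintype.card ↥H : ℂ)⁻¹ *
    ∑ h : G, if hm : h * g * h⁻¹ ∈ H then ψ ⟨h * g * h⁻¹, hm⟩ else 0

open Representation

section Characters

variable {G : Type} [Group G] [Fintype G]

open scoped Matrix ComplexOrder in
/-- Unitary trick: the trace of a matrix representation at `g⁻¹` is conjugate to that at `g`. -/
theorem trace_map_inv_eq_conj {n : Type*} [Fintype n] [DecidableEq n]
    (A : G →* Matrix n n ℂ) (g : G) :
    (A g⁻¹).trace = (starRingEnd ℂ) (A g).trace := by
  set P : Matrix n n ℂ := ∑ h : G, (A h)ᴴ * A h with hP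
  have hpd : P.PosDef := by
    have h1 : P = 1 + ∑ h ∈ Finset.univ.erase (1 : G), (A h)ᴴ * A h := by
      rw [hP, ← Finset.add_sum_erase _ _ (Finset.mem_univ (1 : G))]
      simp
    rw [h1]
    exact Matrix.PosDef.one.add_posSemidef
      (Matrix.posSemidef_sum _ fun h _ => Matrix.posSemidef_conjTranspose_mul_self _)
  have hinv : (A g)ᴴ * P * A g = P := by
    simp only [hP, Finset.mul_sum, Finset.sum_mul]
    refine Fintype.sum_equiv (Equiv.mulRight g) _ _ fun h => ?_
    simp [Matrix.mul_assoc]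
  have hu : IsUnit P.det := (Matrix.isUnit_iff_isUnit_det P).1 hpd.isUnit
  have h2 : (A g)ᴴ = P * A g⁻¹ * P⁻¹ := by
    have h3 : A g * A g⁻¹ = 1 := by rw [← map_mul]; simp
    have h4 : (A g)ᴴ * P = P * A g⁻¹ := by
      conv_rhs => rw [← hinv, Matrix.mul_assoc, h3, Matrix.mul_one]
    rw [← h4, Matrix.mul_assoc, Matrix.mul_nonsing_inv _ hu, Matrix.mul_one]
  have h5 : (starRingEnd ℂ) (A g).trace = ((A g)ᴴ).trace := by
    rw [Matrix.trace_conjTranspose]; rfl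
  rw [h5, h2, Matrix.trace_mul_comm, ← Matrix.mul_assoc, Matrix.nonsing_inv_mul _ hu,
    Matrix.one_mul]

variable {V : Type*} [AddCommGroup V] [Module ℂ V] [FiniteDimensional ℂ V]

theorem Representation.character_inv_eq_conj (ρ : Representation ℂ G V) (g : G) :
    ρ.character g⁻¹ = (starRingEnd ℂ) (ρ.character g) := by
  let b := Module.finBasis ℂ V
  have := trace_map_inv_eq_conj
    ((LinearMap.toMatrixAlgEquiv b).toAlgHom.toRingHom.toMonoidHom.comp ρ) g
  simp only [Representation.character, LinearMap.trace_eq_matrix_trace ℂ b]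
  exact this

theorem innerChar_character {W : Type*} [AddCommGroup W] [Module ℂ W] [FiniteDimensional ℂ W]
    (ρ : Representation ℂ G V) (σ : Representation ℂ G W) :
    innerChar G σ.character ρ.character = Module.finrank ℂ (IntertwiningMap ρ σ) := by
  have : Invertible (Nat.card G : ℂ) := invertibleOfNonzero (by simp)
  rw [← card_inv_mul_sum_char_mul_char_eq_finrank]
  simp [innerChar, Representation.character_inv_eq_conj]

theorem IsChar.exists_rep {χ : G → ℂ} (h : IsChar G χ) :
    ∃ (V : Type) (_ : AddCommGroup V) (_ : Module ℂ V) (_ : FiniteDimensional ℂ V)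
      (ρ : Representation ℂ G V), ρ.character = χ := by
  obtain ⟨V, rfl⟩ := h
  exact ⟨V, inferInstance, inferInstance, inferInstance, V.ρ, rfl⟩

theorem isChar_character {V : Type} [AddCommGroup V] [Module ℂ V] [FiniteDimensional ℂ V]
    (ρ : Representation ℂ G V) : IsChar G ρ.character :=
  ⟨FDRep.of ρ, rfl⟩

theorem IsIrrChar.innerChar_eq_zero {θ η : G → ℂ} (hθ : IsIrrChar G θ) (hη : IsIrrChar G η)
    (hne : θ ≠ η) : innerChar G θ η = 0 := by
  obtain ⟨hθ, hθ1⟩ := hθ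
  obtain ⟨hη, hη1⟩ := hη
  obtain ⟨V, _, _, _, ρ, rfl⟩ := hθ.exists_rep
  obtain ⟨W, _, _, _, σ, rfl⟩ := hη.exists_rep
  set d := Module.finrank ℂ (IntertwiningMap σ ρ) with hd
  have h1 : innerChar G ρ.character σ.character = d := innerChar_character σ ρ
  have h2 : innerChar G σ.character ρ.character = d := by
    have : innerChar G σ.character ρ.character =
        (starRingEnd ℂ) (innerChar G ρ.character σ.character) := by
      simp [innerChar, mul_comm]
    rw [this, h1]; simp
  have hc : (0 : ℝ) < (Fintype.card G : ℝ)⁻¹ := by positivity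
  have h3 : (((Fintype.card G : ℝ)⁻¹ * ∑ g : G, ‖ρ.character g - σ.character g‖ ^ 2 : ℝ) : ℂ) =
      2 - 2 * d := by
    have : (2 : ℂ) - 2 * d = innerChar G ρ.character ρ.character
        - innerChar G ρ.character σ.character - innerChar G σ.character ρ.character
        + innerChar G σ.character σ.character := by
      rw [hθ1, hη1, h1, h2]; ring
    rw [this]
    simp only [innerChar, ← mul_sub, ← mul_add, ← Finset.sum_sub_distrib, ← Finset.sum_add_distrib]
    push_cast
    congr 1
    refine Finset.sum_congr rfl fun g _ => ?_
    rw [← Complex.mul_conj', map_sub]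
    ring
  have h4 : (Fintype.card G : ℝ)⁻¹ * ∑ g : G, ‖ρ.character g - σ.character g‖ ^ 2
      = 2 - 2 * (d : ℝ) := by exact_mod_cast h3
  have h5 : 0 < ∑ g : G, ‖ρ.character g - σ.character g‖ ^ 2 := by
    obtain ⟨g, hg⟩ := Function.ne_iff.1 hne
    refine Finset.sum_pos' (fun _ _ => by positivity) ⟨g, Finset.mem_univ g, ?_⟩
    have := norm_pos_iff.2 (sub_ne_zero.2 hg)
    positivity
  have h6 : (d : ℝ) < 1 := by nlinarith [mul_pos hc h5]
  have h7 : d = 0 := by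
    have : d < 1 := by exact_mod_cast h6
    omega
  rw [h1, h7]; simp

/-- Schur's lemma for a representation whose character has norm one. -/
theorem exists_eq_smul_one_of_commute (ρ : Representation ℂ G V)
    (hρ : innerChar G ρ.character ρ.character = 1) (F : V →ₗ[ℂ] V)
    (hF : ∀ g, F * ρ g = ρ g * F) : ∃ c : ℂ, F = c • (1 : V →ₗ[ℂ] V) := by
  rw [innerChar_character] at hρ
  have h1 : Module.finrank ℂ (IntertwiningMap ρ ρ) = 1 := by exact_mod_cast hρ
  have hone : (1 : IntertwiningMap ρ ρ) ≠ 0 := by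
    intro h0
    have hs : Subsingleton (IntertwiningMap ρ ρ) := subsingleton_of_zero_eq_one h0.symm
    rw [Module.finrank_zero_of_subsingleton] at h1
    omega
  obtain ⟨c, hc⟩ := (finrank_eq_one_iff_of_nonzero' _ hone).1 h1
    ⟨F, fun g => hF g⟩
  exact ⟨c, (congrArg IntertwiningMap.toLinearMap hc).symm⟩

/-- The action of the group-algebra element `∑ g, f g • g` in the representation `ρ`. -/
noncomputable def weightedSum (ρ : Representation ℂ G V) (f : G → ℂ) : V →ₗ[ℂ] V :=
  ∑ g, f g • ρ g

omit [FiniteDimensional ℂ V] in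
theorem trace_mul_weightedSum (ρ : Representation ℂ G V) (F : V →ₗ[ℂ] V) (f : G → ℂ) :
    LinearMap.trace ℂ V (F * weightedSum ρ f) = ∑ g, f g * LinearMap.trace ℂ V (F * ρ g) := by
  simp [weightedSum, Finset.mul_sum]

omit [FiniteDimensional ℂ V] in
theorem trace_weightedSum (ρ : Representation ℂ G V) (f : G → ℂ) :
    LinearMap.trace ℂ V (weightedSum ρ f) = ∑ g, f g * ρ.character g := by
  simpa [Representation.character] using trace_mul_weightedSum ρ 1 f

omit [FiniteDimensional ℂ V] in
theorem weightedSum_commute (ρ : Representation ℂ G V) {f : G → ℂ}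
    (hf : ∀ g h, f (h * g * h⁻¹) = f g) (h : G) :
    weightedSum ρ f * ρ h = ρ h * weightedSum ρ f := by
  simp only [weightedSum, Finset.sum_mul, Finset.mul_sum]
  refine Fintype.sum_equiv (MulAut.conj h⁻¹).toEquiv _ _ fun g => ?_
  have := hf g h⁻¹
  simp only [inv_inv, mul_assoc] at this
  simp [this, ← map_mul, mul_assoc]

omit [FiniteDimensional ℂ V] in
theorem weightedSum_mul (ρ : Representation ℂ G V) (f f' : G → ℂ) :
    weightedSum ρ f * weightedSum ρ f' = weightedSum ρ fun k => ∑ m, f m⁻¹ * f' (m * k) := by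
  simp only [weightedSum, Finset.sum_mul_sum, Finset.sum_smul]
  conv_rhs => rw [Finset.sum_comm]
  refine Fintype.sum_equiv (Equiv.inv G) _ _ fun m => ?_
  refine Fintype.sum_equiv (Equiv.mulLeft m) _ _ fun k => ?_
  simp [smul_smul, mul_comm (f m)]

theorem IsChar.map_inv {θ : G → ℂ} (hθ : IsChar G θ) (g : G) :
    θ g⁻¹ = (starRingEnd ℂ) (θ g) := by
  obtain ⟨V, _, _, _, ρ, rfl⟩ := hθ.exists_rep
  exact ρ.character_inv_eq_conj g

theorem IsChar.map_conj {θ : G → ℂ} (hθ : IsChar G θ) (g h : G) :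
    θ (h * g * h⁻¹) = θ g := by
  obtain ⟨V, _, _, _, ρ, rfl⟩ := hθ.exists_rep
  exact ρ.char_conj g h

theorem IsIrrChar.map_one_ne_zero {θ : G → ℂ} (hθ : IsIrrChar G θ) : θ 1 ≠ 0 := by
  obtain ⟨hθ, hθ1⟩ := hθ
  obtain ⟨V, _, _, _, ρ, rfl⟩ := hθ.exists_rep
  intro h0
  rw [Representation.char_one, Nat.cast_eq_zero, Module.finrank_zero_iff] at h0
  have : ρ.character = 0 := by
    ext g
    simp [Representation.character, Subsingleton.elim (ρ g) 0]
  simp [this, innerChar] at hθ1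

theorem IsIrrChar.exists_sum_conj_mul {θ η : G → ℂ} (hθ : IsChar G θ) (hη : IsIrrChar G η) :
    ∃ c : ℂ, (∀ k, ∑ m, (starRingEnd ℂ) (θ m) * η (m * k) = c * η k) ∧
      c * η 1 = Fintype.card G * innerChar G η θ := by
  obtain ⟨V, _, _, _, ρ, rfl⟩ := hη.1.exists_rep
  obtain ⟨c, hc⟩ := exists_eq_smul_one_of_commute ρ hη.2
    (weightedSum ρ fun g => (starRingEnd ℂ) (θ g))
    (weightedSum_commute ρ fun g h => by rw [hθ.map_conj])
  have key : ∀ k, ∑ m, (starRingEnd ℂ) (θ m) * ρ.character (m * k) = c * ρ.character k := by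
    intro k
    have := trace_mul_weightedSum ρ (ρ k) fun g => (starRingEnd ℂ) (θ g)
    rw [hc] at this
    simp only [mul_smul_comm, mul_one, map_smul, smul_eq_mul, ← map_mul] at this
    simp_rw [ρ.char_mul_comm k]
    exact this.symm
  refine ⟨c, key, ?_⟩
  rw [← key 1, innerChar, mul_inv_cancel_left₀ (by simp)]
  simp [mul_comm]

/-- The action of `∑ g, conj (θ g) • g`. When `θ` is an irreducible character, it is a nonzero
multiple of the projection onto the `θ`-isotypic component of `ρ`. -/
noncomputable def isotypicSum (ρ : Representation ℂ G V) (θ : G → ℂ) : V →ₗ[ℂ] V :=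
  weightedSum ρ fun g => (starRingEnd ℂ) (θ g)

omit [FiniteDimensional ℂ V] in
theorem exists_isotypicSum_mul (ρ : Representation ℂ G V) {θ η : G → ℂ} (hθ : IsChar G θ)
    (hη : IsIrrChar G η) :
    ∃ c : ℂ, isotypicSum ρ θ * isotypicSum ρ η = c • isotypicSum ρ η ∧
      (innerChar G η θ = 0 → c = 0) ∧ (innerChar G η θ ≠ 0 → c ≠ 0) := by
  obtain ⟨c, hc, hc1⟩ := hη.exists_sum_conj_mul hθ
  refine ⟨(starRingEnd ℂ) c, ?_, fun h => ?_, fun h h0 => ?_⟩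
  · rw [isotypicSum, isotypicSum, weightedSum_mul]
    simp only [weightedSum, Finset.smul_sum, smul_smul, ← map_mul, ← hc]
    simp [hθ.map_inv]
  · have := hη.map_one_ne_zero
    simp_all
  · have : c = 0 := by simpa using h0
    simp_all

omit [FiniteDimensional ℂ V] in
theorem isotypicSum_mul_of_ne (ρ : Representation ℂ G V) {θ η : G → ℂ} (hθ : IsIrrChar G θ)
    (hη : IsIrrChar G η) (hne : θ ≠ η) : isotypicSum ρ θ * isotypicSum ρ η = 0 := by
  obtain ⟨c, hc, h0, -⟩ := exists_isotypicSum_mul ρ hθ.1 hη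
  rw [hc, h0 (hη.innerChar_eq_zero hθ hne.symm), zero_smul]

omit [FiniteDimensional ℂ V] in
theorem exists_isotypicSum_mul_self (ρ : Representation ℂ G V) {θ : G → ℂ}
    (hθ : IsIrrChar G θ) :
    ∃ c : ℂ, c ≠ 0 ∧ isotypicSum ρ θ * isotypicSum ρ θ = c • isotypicSum ρ θ := by
  obtain ⟨c, hc, -, h0⟩ := exists_isotypicSum_mul ρ hθ.1 hθ
  exact ⟨c, h0 (by simp [hθ.2]), hc⟩

omit [FiniteDimensional ℂ V] in
theorem trace_isotypicSum (ρ : Representation ℂ G V) (θ : G → ℂ) :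
    LinearMap.trace ℂ V (isotypicSum ρ θ) =
      Fintype.card G * innerChar G ρ.character θ := by
  rw [isotypicSum, trace_weightedSum, innerChar, mul_inv_cancel_left₀ (by simp)]
  simp [mul_comm]

theorem isotypicSum_eq_zero (ρ : Representation ℂ G V) {θ : G → ℂ} (hθ : IsIrrChar G θ)
    (h : innerChar G ρ.character θ = 0) : isotypicSum ρ θ = 0 := by
  obtain ⟨c, hc, hmul⟩ := exists_isotypicSum_mul_self ρ hθ
  have hid : IsIdempotentElem (c⁻¹ • isotypicSum ρ θ) := by
    rw [IsIdempotentElem, smul_mul_smul_comm, hmul, smul_smul]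
    field_simp
  have htr : LinearMap.trace ℂ V (c⁻¹ • isotypicSum ρ θ) = 0 := by
    rw [map_smul, trace_isotypicSum, h]; simp
  simpa [hc] using (LinearMap.IsIdempotentElem.trace_eq_zero_iff hid).1 htr

open scoped MonoidAlgebra in
theorem sum_smul_of_smul_eq_zero {f : G → ℂ} (hf : ∀ g h, f (h * g * h⁻¹) = f g)
    (h0 : ∀ θ, IsIrrChar G θ → ∑ g, f g * θ g = 0)
    {M : Type} [AddCommGroup M] [Module ℂ M] [Module ℂ[G] M] [IsScalarTower ℂ ℂ[G] M]
    [IsSimpleModule ℂ[G] M] (s : M) :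
    (∑ g, f g • MonoidAlgebra.of ℂ G g) • s = 0 := by
  let ρ : Representation ℂ G M := Representation.ofModule' M
  have hρ : ∀ (r : ℂ[G]) (m : M), ρ.asAlgebraHom r m = r • m := by
    intro r m
    have : ρ.asAlgebraHom = Algebra.lsmul ℂ ℂ M :=
      (MonoidAlgebra.lift ℂ (M →ₗ[ℂ] M) G).apply_symm_apply _
    rw [this]
    rfl
  have hirr : ρ.IsIrreducible := by
    rw [irreducible_iff_isSimpleModule_asModule]
    let e : ρ.asModule ≃ₗ[ℂ[G]] M :=
      { ρ.asModuleEquiv with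
        map_smul' := fun r m => (ρ.asModuleEquiv_map_smul r m).trans (hρ r _) }
    exact IsSimpleModule.congr e
  have hfin : FiniteDimensional ℂ M := Module.Finite.trans ℂ[G] M
  have hIrr : IsIrrChar G ρ.character := by
    refine ⟨isChar_character ρ, ?_⟩
    rw [innerChar_character]
    simp
  obtain ⟨c, hc⟩ := exists_eq_smul_one_of_commute ρ hIrr.2 (weightedSum ρ f)
    (weightedSum_commute ρ hf)
  have htr := trace_weightedSum ρ f
  rw [h0 _ hIrr, hc, map_smul, LinearMap.trace_one, smul_eq_mul] at htr
  have hc0 : c = 0 := by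
    refine (mul_eq_zero.1 htr).resolve_right ?_
    simpa using hIrr.map_one_ne_zero
  have h1 : ρ.asAlgebraHom (∑ g, f g • MonoidAlgebra.of ℂ G g) = 0 := by
    have : weightedSum ρ f = 0 := by rw [hc, hc0, zero_smul]
    simpa [weightedSum] using this
  rw [← hρ, h1, LinearMap.zero_apply]

open scoped MonoidAlgebra in
/-- A class function orthogonal to all irreducible characters vanishes. -/
theorem eq_zero_of_sum_mul_irrChar_eq_zero {f : G → ℂ} (hf : ∀ g h, f (h * g * h⁻¹) = f g)
    (h0 : ∀ θ, IsIrrChar G θ → ∑ g, f g * θ g = 0) : f = 0 := by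
  set a : ℂ[G] := ∑ g, f g • MonoidAlgebra.of ℂ G g with ha
  have hann : ∀ S : Submodule ℂ[G] ℂ[G], IsSimpleModule ℂ[G] S → ∀ s ∈ S, a * s = 0 :=
    fun S hS s hs => congrArg Subtype.val (sum_smul_of_smul_eq_zero hf h0 (⟨s, hs⟩ : S))
  have hall : ∀ s : ℂ[G], a * s = 0 := by
    intro s
    have hs : s ∈ sSup {m : Submodule ℂ[G] ℂ[G] | IsSimpleModule ℂ[G] m} := by
      rw [IsSemisimpleModule.sSup_simples_eq_top]; trivial
    rw [sSup_eq_iSup'] at hs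
    refine Submodule.iSup_induction _ (motive := fun s => a * s = 0) hs
      (fun S t ht => hann S S.2 t ht) (mul_zero a) fun s t hs ht => ?_
    rw [mul_add, hs, ht, add_zero]
  have ha0 : a = 0 := by simpa using hall 1
  ext g
  have := congrArg (fun b : ℂ[G] => b.coeff g) ha0
  simpa [ha, MonoidAlgebra.of_apply, Finsupp.single_apply] using this

/-- A function orthogonal to all irreducible characters vanishes at the identity. -/
theorem map_one_eq_zero_of_sum_conj_irrChar_mul_eq_zero {F : G → ℂ}
    (h0 : ∀ θ, IsIrrChar G θ → ∑ g, (starRingEnd ℂ) (θ g) * F g = 0) : F 1 = 0 := by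
  have := eq_zero_of_sum_mul_irrChar_eq_zero (f := fun g => ∑ m, F (m * g⁻¹ * m⁻¹)) ?_ ?_
  · have h1 := congrFun this 1
    simpa using h1
  · intro g h
    refine Fintype.sum_equiv (Equiv.mulRight h) _ _ fun m => ?_
    simp [mul_assoc]
  · intro θ hθ
    simp only [Finset.sum_mul]
    rw [Finset.sum_comm]
    refine Finset.sum_eq_zero fun m _ => ?_
    rw [← h0 θ hθ]
    refine Fintype.sum_equiv ((Equiv.inv G).trans (MulAut.conj m).toEquiv) _ _ fun g => ?_
    simp [hθ.1.map_conj, hθ.1.map_inv, mul_comm]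

theorem IsIrrChar.comp_mulEquiv {θ : G → ℂ} (hθ : IsIrrChar G θ) (a : G ≃* G) :
    IsIrrChar G (fun g => θ (a g)) := by
  obtain ⟨hθ, hθ1⟩ := hθ
  obtain ⟨V, _, _, _, ρ, rfl⟩ := hθ.exists_rep
  refine ⟨isChar_character (ρ.comp a.toMonoidHom), ?_⟩
  rw [← hθ1, innerChar, innerChar]
  congr 1
  exact Fintype.sum_equiv a.toEquiv _ _ fun g => rfl

end Characters

section Clifford

variable {G : Type} [Group G] [Fintype G] {N : Subgroup G} [N.Normal]
  {V : Type*} [AddCommGroup V] [Module ℂ V]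

theorem map_mul_isotypicSum (ρ : Representation ℂ G V) (θ : N → ℂ) (g : G) :
    ρ g * isotypicSum (ρ.comp N.subtype) (fun n => θ (MulAut.conjNormal g n)) =
      isotypicSum (ρ.comp N.subtype) θ * ρ g := by
  simp only [isotypicSum, weightedSum, Finset.sum_mul, Finset.mul_sum]
  refine Fintype.sum_equiv (MulAut.conjNormal g).toEquiv _ _ fun n => ?_
  simp [← map_mul]

theorem trace_mul_isotypicSum_eq_zero (ρ : Representation ℂ G V) {θ : N → ℂ}
    (hθ : IsIrrChar N θ) (g : G) (hg : (fun n => θ (MulAut.conjNormal g n)) ≠ θ) :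
    LinearMap.trace ℂ V (ρ g * isotypicSum (ρ.comp N.subtype) θ) = 0 := by
  obtain ⟨c, hc, hmul⟩ := exists_isotypicSum_mul_self (ρ.comp N.subtype) hθ
  have h1 : LinearMap.trace ℂ V (ρ g * (isotypicSum (ρ.comp N.subtype) θ *
      isotypicSum (ρ.comp N.subtype) θ)) = 0 := by
    rw [← mul_assoc, LinearMap.trace_mul_comm, ← mul_assoc, ← map_mul_isotypicSum, mul_assoc,
      isotypicSum_mul_of_ne _ (hθ.comp_mulEquiv _) hθ hg, mul_zero, map_zero]
  rw [hmul, mul_smul_comm, map_smul, smul_eq_mul] at h1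
  exact (mul_eq_zero.1 h1).resolve_left hc

theorem exists_isotypicSum_eq_smul_one [FiniteDimensional ℂ V] {T : Subgroup G} (hNT : N ≤ T)
    (σ : Representation ℂ T V) (hσ : innerChar T σ.character σ.character = 1) {θ : N → ℂ}
    (hT : ∀ t ∈ T, (fun n => θ (MulAut.conjNormal t n)) = θ)
    (hover : innerChar N (Representation.character (σ.comp (Subgroup.inclusion hNT))) θ ≠ 0) :
    ∃ s : ℂ, s ≠ 0 ∧
      isotypicSum (σ.comp (Subgroup.inclusion hNT)) θ = s • (1 : V →ₗ[ℂ] V) := by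
  set τ : Representation ℂ N V := σ.comp (Subgroup.inclusion hNT) with hτ
  obtain ⟨s, hs⟩ := exists_eq_smul_one_of_commute σ hσ (isotypicSum τ θ) fun t => by
    conv_rhs => rw [← hT t t.2]
    simp only [isotypicSum, weightedSum, Finset.sum_mul, Finset.mul_sum]
    refine (Fintype.sum_equiv (MulAut.conjNormal (t : G)).toEquiv _ _ fun n => ?_).symm
    simp only [hτ, MonoidHom.comp_apply, mul_smul_comm, smul_mul_assoc, ← map_mul]
    congr 2
    ext
    simp
  refine ⟨s, ?_, hs⟩
  rintro rfl
  have := trace_isotypicSum τ θ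
  rw [hs, zero_smul, map_zero] at this
  exact hover ((mul_eq_zero.1 this.symm).resolve_left (by simp))

end Clifford

theorem stmt_9 {G : Type} [Group G] [Fintype G] (x : G) (N : Subgroup G)
    (hN : N.Normal) (χ : G → ℂ) (hχ : IsIrrChar G χ) (hx : χ x ≠ 0) :
    ∃ θ : ↥N → ℂ, IsIrrChar ↥N θ ∧ innerChar ↥N (fun n => χ ↑n) θ ≠ 0 ∧
      (∀ n : ↥N, θ ⟨x * ↑n * x⁻¹, hN.conj_mem ↑n n.2 x⟩ = θ n) ∧
      ∀ T : Subgroup G,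
        (∀ g : G, g ∈ T ↔ ∀ n : ↥N, θ ⟨g * ↑n * g⁻¹, hN.conj_mem ↑n n.2 g⟩ = θ n) →
        ∀ hNT : N ≤ T, ∀ hxT : x ∈ T, ∀ ψ : ↥T → ℂ, IsIrrChar ↥T ψ →
          innerChar ↥N (fun n => ψ ⟨↑n, hNT n.2⟩) θ ≠ 0 →
          indChar T ψ = χ → ψ ⟨x, hxT⟩ ≠ 0 := by
  have hχx : ∃ θ : N → ℂ, IsIrrChar N θ ∧
      ∑ n : N, (starRingEnd ℂ) (θ n) * χ (x * n) ≠ 0 := by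
    by_contra! hcon
    have := map_one_eq_zero_of_sum_conj_irrChar_mul_eq_zero (F := fun n : N => χ (x * n)) hcon
    simp [hx] at this
  obtain ⟨θ, hθ, hS⟩ := hχx
  obtain ⟨V, _, _, _, ρ, rfl⟩ := hχ.1.exists_rep
  have htr : LinearMap.trace ℂ V (ρ x * isotypicSum (ρ.comp N.subtype) θ) ≠ 0 := by
    rw [isotypicSum, trace_mul_weightedSum]
    simpa [Representation.character] using hS
  refine ⟨θ, hθ, fun h0 => ?_, ?_, ?_⟩
  · rw [isotypicSum_eq_zero (ρ.comp N.subtype) hθ h0, mul_zero, map_zero] at htr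
    exact htr rfl
  · by_contra hcon
    exact htr (trace_mul_isotypicSum_eq_zero ρ hθ x fun h => hcon fun n => congrFun h n)
  · intro T hT hNT hxT ψ hψ hover hind hψx
    obtain ⟨W, _, _, _, σ, rfl⟩ := hψ.1.exists_rep
    have hT' : ∀ t : G, t ∈ T ↔ (fun n => θ (MulAut.conjNormal t n)) = θ :=
      fun t => (hT t).trans ⟨fun h => funext h, fun h n => congrFun h n⟩
    apply hS
    rw [← hind]
    simp only [indChar, Finset.mul_sum]
    rw [Finset.sum_comm]
    refine Finset.sum_eq_zero fun h _ => ?_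
    by_cases hy : h * x * h⁻¹ ∈ T
    · let τ : Representation ℂ N W := σ.comp (Subgroup.inclusion hNT)
      let η : N → ℂ := fun n => θ (MulAut.conjNormal h⁻¹ n)
      obtain ⟨s, hs0, hs⟩ :=
        exists_isotypicSum_eq_smul_one hNT σ hψ.2 (fun t ht => (hT' t).1 ht) hover
      have hzero : LinearMap.trace ℂ W (σ ⟨h * x * h⁻¹, hy⟩ * isotypicSum τ η) = 0 := by
        by_cases hη : η = θ
        · have hhT : h ∈ T := inv_mem_iff.1 ((hT' h⁻¹).2 hη)
          have hconj : (⟨h * x * h⁻¹, hy⟩ : T) = ⟨h, hhT⟩ * ⟨x, hxT⟩ * ⟨h, hhT⟩⁻¹ := rfl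
          rw [hη, hs, mul_smul_comm, mul_one, map_smul, hconj]
          have := σ.char_conj ⟨x, hxT⟩ ⟨h, hhT⟩
          rw [hψx] at this
          exact (congrArg (s • ·) this).trans (smul_zero s)
        · have := isotypicSum_mul_of_ne τ (hθ.comp_mulEquiv (MulAut.conjNormal h⁻¹)) hθ hη
          rw [hs, mul_smul_comm, mul_one] at this
          rw [(smul_eq_zero.1 this).resolve_left hs0, mul_zero, map_zero]
      rw [isotypicSum, trace_mul_weightedSum] at hzero
      rw [← mul_zero (Fintype.card T : ℂ)⁻¹, ← hzero, Finset.mul_sum]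
      refine Fintype.sum_equiv (MulAut.conjNormal h).toEquiv _ _ fun n => ?_
      have heq : h * (x * n) * h⁻¹ = h * x * h⁻¹ * (h * n * h⁻¹) := by group
      have hmem : h * (x * n) * h⁻¹ ∈ T := by
        rw [heq]
        exact mul_mem hy (hNT (hN.conj_mem n n.2 h))
      have hσ : σ ⟨h * (x * n) * h⁻¹, hmem⟩ =
          σ ⟨h * x * h⁻¹, hy⟩ * τ (MulAut.conjNormal h n) := by
        rw [show τ (MulAut.conjNormal h n) =
          σ (Subgroup.inclusion hNT (MulAut.conjNormal h n)) from rfl, ← map_mul]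
        congr 1
        exact Subtype.ext heq
      rw [dif_pos hmem, Representation.character, hσ]
      simp [η]
      ring
    · refine Finset.sum_eq_zero fun n _ => ?_
      have heq : h * (x * n) * h⁻¹ = h * x * h⁻¹ * (h * n * h⁻¹) := by group
      rw [dif_neg, mul_zero, mul_zero]
      rw [heq, Subgroup.mul_mem_cancel_right T (hNT (hN.conj_mem n n.2 h))]
      exact hy
end

section
/- Let A be a p-group acting by automorphisms on a finite group G of order coprime to p, let C = C_G(A), and let C ≤ H ≤ G be an A-invariant subgroup. Then the A-Glauberman correspondence Irr_A(G) → Irr(C) factors through H: there is a bijection f_A : Irr_A(G) → Irr_A(H) such that for each θ ∈ Irr_A(G), the Glauberman correspondents of θ and of f_A(θ) in Irr(C) coincide. -/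
attribute [local instance] Classical.propDecidable

section Characters

open Module

variable {G : Type} [Group G]

theorem Representation.ofModule'_apply (M : Type*) [AddCommGroup M] [Module ℂ M]
    [Module (MonoidAlgebra ℂ G) M] [IsScalarTower ℂ (MonoidAlgebra ℂ G) M] (g : G) (m : M) :
    Representation.ofModule' (k := ℂ) (G := G) M g m = MonoidAlgebra.single g (1 : ℂ) • m := by
  simp [Representation.ofModule']

theorem finrank_intertwiningMap_ofModule' (M : Type) [AddCommGroup M] [Module ℂ M]
    [Module (MonoidAlgebra ℂ G) M] [IsScalarTower ℂ (MonoidAlgebra ℂ G) M] [FiniteDimensional ℂ M]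
    [IsSimpleModule (MonoidAlgebra ℂ G) M] :
    finrank ℂ (Representation.IntertwiningMap (Representation.ofModule' (k := ℂ) (G := G) M)
      (Representation.ofModule' (k := ℂ) (G := G) M)) = 1 := by
  let I : Representation.IntertwiningMap (Representation.ofModule' (k := ℂ) (G := G) M)
    (Representation.ofModule' (k := ℂ) (G := G) M) :=
    { toLinearMap := LinearMap.id, isIntertwining' := fun _ => rfl }
  have hI : I ≠ 0 := by
    intro hI
    have := IsSimpleModule.nontrivial (MonoidAlgebra ℂ G) M
    obtain ⟨m, hm⟩ := exists_ne (0 : M)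
    exact hm (LinearMap.congr_fun (congrArg (fun f => f.toLinearMap) hI) m)
  refine (finrank_eq_one_iff_of_nonzero' I hI).2 fun f => ?_
  have hsmul : ∀ (r : MonoidAlgebra ℂ G) (m : M), f.toLinearMap (r • m) = r • f.toLinearMap m := by
    intro r m
    induction r using MonoidAlgebra.induction_on with
    | of x =>
      have := LinearMap.congr_fun (f.isIntertwining' x) m
      simpa [Representation.ofModule'_apply, MonoidAlgebra.of_apply] using this
    | add y z hy hz => rw [add_smul, map_add, hy, hz, add_smul]
    | smul r y hy => rw [smul_assoc, map_smul, hy, smul_assoc]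
  let f' : Module.End (MonoidAlgebra ℂ G) M :=
    { toFun := f.toLinearMap, map_add' := map_add _, map_smul' := hsmul }
  obtain ⟨c, hc⟩ := (IsSimpleModule.algebraMap_end_bijective_of_isAlgClosed ℂ
    (A := MonoidAlgebra ℂ G) (V := M)).2 f'
  refine ⟨c, Representation.IntertwiningMap.ext (LinearMap.ext fun m => ?_)⟩
  exact LinearMap.congr_fun hc m

variable [Fintype G]

theorem Module.End.iSup_eigenspace_eq_top_of_pow_eq_one {V : Type*} [AddCommGroup V] [Module ℂ V]
    [FiniteDimensional ℂ V] {T : Module.End ℂ V} {n : ℕ} (hn : n ≠ 0) (hT : T ^ n = 1) :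
    ⨆ μ, T.eigenspace μ = ⊤ := by
  have hsq : Squarefree (Polynomial.X ^ n - 1 : Polynomial ℂ) :=
    (Polynomial.separable_X_pow_sub_C (1 : ℂ) (by exact_mod_cast hn) one_ne_zero).squarefree
  have hss := Module.End.isSemisimple_of_squarefree_aeval_eq_zero (f := T) hsq (by simp [hT])
  rw [← hss.isFinitelySemisimple.iSup_maxGenEigenspace_eq_top_iff]
  exact Module.End.iSup_maxGenEigenspace_eq_top T

/-- The eigenvalues of a finite-order operator are roots of unity, and they compute both its trace
and that of its inverse. -/
theorem FDRep.exists_sum_roots_of_unity (V : FDRep ℂ G) (g : G) :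
    ∃ (s : Finset ℂ) (m : ℂ → ℕ), (∀ μ ∈ s, μ ^ Fintype.card G = 1) ∧
      V.character g = ∑ μ ∈ s, m μ * μ ∧ V.character g⁻¹ = ∑ μ ∈ s, m μ * μ⁻¹ := by
  set T : Module.End ℂ V := V.ρ g with hTdef
  have hT : T ^ Fintype.card G = 1 := by rw [hTdef, ← map_pow, pow_card_eq_one, map_one]
  have hint : DirectSum.IsInternal T.eigenspace :=
    DirectSum.isInternal_submodule_of_iSupIndep_of_iSup_eq_top T.eigenspaces_iSupIndep
      (Module.End.iSup_eigenspace_eq_top_of_pow_eq_one Fintype.card_ne_zero hT)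
  have hfin : {μ | T.eigenspace μ ≠ ⊥}.Finite :=
    WellFoundedGT.finite_ne_bot_of_iSupIndep T.eigenspaces_iSupIndep
  have hpow : ∀ (k : ℕ) {μ : ℂ} {v : V}, v ∈ T.eigenspace μ → (T ^ k) v = μ ^ k • v := by
    intro k μ v hv
    rw [Module.End.mem_eigenspace_iff] at hv
    induction k with
    | zero => simp
    | succ k ih => rw [pow_succ, Module.End.mul_apply, hv, map_smul, ih, smul_smul, pow_succ']
  have hroot : ∀ μ ∈ hfin.toFinset, μ ^ Fintype.card G = 1 := by
    intro μ hμ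
    obtain ⟨v, hv, hv0⟩ := Submodule.exists_mem_ne_zero_of_ne_bot (hfin.mem_toFinset.1 hμ)
    have := hpow (Fintype.card G) hv
    rw [hT, Module.End.one_apply] at this
    exact smul_left_injective ℂ hv0 (by simpa using this.symm)
  have hinv : ∀ {μ : ℂ} {v : V}, v ∈ T.eigenspace μ → V.ρ g⁻¹ v = μ⁻¹ • v := by
    intro μ v hv
    by_cases hv0 : v = 0
    · simp [hv0]
    have hμ : μ ∈ hfin.toFinset := hfin.mem_toFinset.2 fun h => hv0 (by simpa [h] using hv)
    have hμ0 : μ ≠ 0 := by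
      rintro rfl
      simpa [zero_pow Fintype.card_ne_zero] using hroot 0 hμ
    have h1 : V.ρ g⁻¹ (T v) = v := by
      rw [hTdef, ← Module.End.mul_apply, ← map_mul]; simp
    rw [Module.End.mem_eigenspace_iff.1 hv, map_smul] at h1
    rw [eq_inv_smul_iff₀ hμ0, h1]
  have htr : ∀ (S : Module.End ℂ V) (c : ℂ → ℂ),
      (∀ μ, ∀ v ∈ T.eigenspace μ, S v = c μ • v) →
      LinearMap.trace ℂ V S = ∑ μ ∈ hfin.toFinset, finrank ℂ (T.eigenspace μ) * c μ := by
    intro S c hS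
    have hmaps : ∀ μ, Set.MapsTo S (T.eigenspace μ) (T.eigenspace μ) := by
      intro μ v hv
      rw [hS μ v hv]
      exact Submodule.smul_mem _ _ hv
    rw [LinearMap.trace_eq_sum_trace_restrict' hint hfin hmaps]
    refine Finset.sum_congr rfl fun μ _ => ?_
    have : S.restrict (hmaps μ) = c μ • LinearMap.id := by
      ext v
      exact hS μ v v.2
    rw [this, map_smul, LinearMap.trace_id, smul_eq_mul, mul_comm]
  exact ⟨hfin.toFinset, fun μ => finrank ℂ (T.eigenspace μ), hroot,
    htr T id fun μ v hv => Module.End.mem_eigenspace_iff.1 hv,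
    htr (V.ρ g⁻¹) (·⁻¹) fun μ v hv => hinv hv⟩

theorem IsChar.isIntegral {χ : G → ℂ} (h : IsChar G χ) (g : G) : IsIntegral ℤ (χ g) := by
  obtain ⟨V, rfl⟩ := h
  obtain ⟨s, m, hs, h1, -⟩ := V.exists_sum_roots_of_unity g
  rw [h1]
  refine IsIntegral.sum _ fun μ hμ => (isIntegral_algebraMap (R := ℤ) (x := (m μ : ℤ))).mul ?_
  exact IsIntegral.of_pow Fintype.card_pos (by rw [hs μ hμ]; exact isIntegral_one)

theorem IsChar.conj_apply {χ : G → ℂ} (h : IsChar G χ) (g : G) :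
    (starRingEnd ℂ) (χ g) = χ g⁻¹ := by
  obtain ⟨V, rfl⟩ := h
  obtain ⟨s, m, hs, h1, h2⟩ := V.exists_sum_roots_of_unity g
  rw [h1, h2, map_sum]
  refine Finset.sum_congr rfl fun μ hμ => ?_
  have : ‖μ‖ = 1 := by
    rw [← pow_eq_one_iff_of_nonneg (norm_nonneg μ) (Fintype.card_ne_zero (α := G)), ← norm_pow,
      hs μ hμ, norm_one]
  rw [map_mul, map_natCast, Complex.inv_def, Complex.normSq_eq_norm_sq, this]
  simp

theorem IsChar.apply_conj {χ : G → ℂ} (h : IsChar G χ) (x g : G) : χ (x * g * x⁻¹) = χ g := by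
  obtain ⟨V, rfl⟩ := h
  exact V.char_conj g x

theorem IsChar.comp {K : Type} [Group K] [Fintype K] {χ : G → ℂ} (h : IsChar G χ) (φ : K →* G) :
    IsChar K fun k => χ (φ k) := by
  obtain ⟨V, rfl⟩ := h
  exact ⟨FDRep.of (V.ρ.comp φ), rfl⟩

theorem innerChar_of_isChar {α β : G → ℂ} (h : IsChar G β) :
    innerChar G α β = (Fintype.card G : ℂ)⁻¹ * ∑ g, α g * β g⁻¹ := by
  simp only [innerChar, h.conj_apply]

/-- The inner product of two characters is the dimension of the space of intertwining maps. -/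
theorem innerChar_eq_finrank (V W : FDRep ℂ G) :
    innerChar G W.character V.character = finrank ℂ (Representation.IntertwiningMap V.ρ W.ρ) := by
  have : Invertible (Nat.card G : ℂ) := invertibleOfNonzero (by simp)
  rw [innerChar_of_isChar ⟨V, rfl⟩, Fintype.card_eq_nat_card]
  exact Representation.card_inv_mul_sum_char_mul_char_eq_finrank V.ρ W.ρ

theorem IsChar.exists_innerChar_eq_natCast {α β : G → ℂ} (hα : IsChar G α) (hβ : IsChar G β) :
    ∃ m : ℕ, innerChar G α β = m := by
  obtain ⟨W, rfl⟩ := hα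
  obtain ⟨V, rfl⟩ := hβ
  exact ⟨_, innerChar_eq_finrank V W⟩

theorem IsIrrChar.innerChar_eq_zero_s12 {χ ψ : G → ℂ} (hχ : IsIrrChar G χ) (hψ : IsIrrChar G ψ)
    (hne : χ ≠ ψ) : innerChar G χ ψ = 0 := by
  have hsimple : ∀ V : FDRep ℂ G, innerChar G V.character V.character = 1 →
      CategoryTheory.Simple V := by
    intro V hV
    rw [FDRep.simple_iff_char_is_norm_one]
    rw [innerChar_of_isChar ⟨V, rfl⟩, inv_mul_eq_one₀ (by simp)] at hV
    rw [← hV, Nat.card_eq_fintype_card]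
  obtain ⟨⟨V, rfl⟩, hV⟩ := hχ
  obtain ⟨⟨W, rfl⟩, hW⟩ := hψ
  have := hsimple V hV
  have := hsimple W hW
  have : Invertible (Nat.card G : ℂ) := invertibleOfNonzero (by simp)
  rw [innerChar_of_isChar ⟨W, rfl⟩, Fintype.card_eq_nat_card, FDRep.char_orthonormal, if_neg]
  rintro ⟨i⟩
  exact hne (FDRep.char_iso i)

/-- **Schur lemma** for a class function acting on an irreducible representation. -/
theorem exists_sum_smul_eq_smul_id (V : FDRep ℂ G)
    (hV : finrank ℂ (Representation.IntertwiningMap V.ρ V.ρ) = 1) (F : G → ℂ)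
    (hF : ∀ x g, F (x * g * x⁻¹) = F g) :
    ∃ c : ℂ, ∑ g, F g • V.ρ g = c • (1 : Module.End ℂ V) := by
  have hcomm : ∀ x, (∑ g, F g • V.ρ g) * V.ρ x = V.ρ x * ∑ g, F g • V.ρ g := by
    intro x
    rw [Finset.sum_mul, Finset.mul_sum]
    refine Fintype.sum_equiv (MulAut.conj x⁻¹).toEquiv _ _ fun g => ?_
    have h1 : F (x⁻¹ * (g * x)) = F g := by simpa [mul_assoc] using hF x⁻¹ g
    simp [h1, ← map_mul, mul_assoc]
  let T : Representation.IntertwiningMap V.ρ V.ρ :=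
    { toLinearMap := ∑ g, F g • V.ρ g, isIntertwining' := hcomm }
  let I : Representation.IntertwiningMap V.ρ V.ρ :=
    { toLinearMap := 1, isIntertwining' := fun _ => rfl }
  have hI : I ≠ 0 := by
    intro hI
    have h0 : (1 : Module.End ℂ V) = 0 := congrArg (fun f => f.toLinearMap) hI
    have : Subsingleton (Representation.IntertwiningMap V.ρ V.ρ) := by
      refine ⟨fun f g => ?_⟩
      ext v
      have hv : v = 0 := by simpa using LinearMap.congr_fun h0 v
      simp [hv]
    rw [finrank_zero_of_subsingleton] at hV
    exact zero_ne_one hV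
  obtain ⟨c, hc⟩ := (finrank_eq_one_iff_of_nonzero' I hI).1 hV T
  exact ⟨c, (congrArg (fun f => f.toLinearMap) hc).symm⟩

theorem finrank_intertwiningMap_eq_one {V : FDRep ℂ G}
    (hV : innerChar G V.character V.character = 1) :
    finrank ℂ (Representation.IntertwiningMap V.ρ V.ρ) = 1 := by
  rw [innerChar_eq_finrank] at hV
  exact_mod_cast hV

theorem trace_sum_smul (V : FDRep ℂ G) (F : G → ℂ) :
    LinearMap.trace ℂ V (∑ g, F g • V.ρ g) = ∑ g, F g * V.character g := by
  simp [map_sum, FDRep.character]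

theorem IsIrrChar.one_mul_sum_apply_mul {χ : G → ℂ} (hχ : IsIrrChar G χ) (F : G → ℂ)
    (hF : ∀ x g, F (x * g * x⁻¹) = F g) (x : G) :
    χ 1 * ∑ g, F g * χ (g * x) = (∑ g, F g * χ g) * χ x := by
  obtain ⟨⟨V, rfl⟩, hV⟩ := hχ
  obtain ⟨c, hc⟩ := exists_sum_smul_eq_smul_id V (finrank_intertwiningMap_eq_one hV) F hF
  have h1 : ∑ g, F g * V.character g = c * V.character 1 := by
    rw [← trace_sum_smul, hc, map_smul, smul_eq_mul, FDRep.char_one, LinearMap.trace_one]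
  have h2 : ∑ g, F g * V.character (g * x) = c * V.character x := by
    calc _ = LinearMap.trace ℂ V ((∑ g, F g • V.ρ g) * V.ρ x) := by
          simp [Finset.sum_mul, map_sum, FDRep.character]
      _ = _ := by rw [hc]; simp [FDRep.character]
  rw [h1, h2]
  ring

theorem IsIrrChar.apply_one_ne_zero {χ : G → ℂ} (hχ : IsIrrChar G χ) : χ 1 ≠ 0 := by
  intro h0
  have h := hχ.one_mul_sum_apply_mul (fun g => χ g⁻¹)
    (fun x g => by rw [← hχ.1.apply_conj x g⁻¹]; simp [mul_assoc])
  have h1 := hχ.2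
  rw [innerChar_of_isChar hχ.1, inv_mul_eq_one₀ (by simp)] at h1
  have hz : ∀ x, χ x = 0 := by
    intro x
    have := h x
    rw [h0, zero_mul] at this
    simp_rw [mul_comm (χ _⁻¹)] at this
    rw [← h1] at this
    simpa using this.symm
  simp [hz] at h1

/-- The irreducible characters span the class functions: a class function orthogonal to all
irreducible characters vanishes. -/
theorem eq_zero_of_forall_innerChar_eq_zero (F : G → ℂ) (hF : ∀ x g, F (x * g * x⁻¹) = F g)
    (h : ∀ χ, IsIrrChar G χ → innerChar G F χ = 0) : F = 0 := by
  have hNeZ : NeZero (Nat.card G : ℂ) := ⟨by simp⟩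
  set a : MonoidAlgebra ℂ G := ∑ g, MonoidAlgebra.single g (F g⁻¹) with ha
  have hF' : ∀ x g, F (x * g * x⁻¹)⁻¹ = F g⁻¹ := fun x g => by
    rw [← hF x g⁻¹]; simp [mul_assoc]
  have hcomm : ∀ y, a * y = y * a := by
    intro y
    induction y using MonoidAlgebra.induction_on with
    | of x =>
      rw [ha, Finset.sum_mul, Finset.mul_sum]
      refine Fintype.sum_equiv (MulAut.conj x⁻¹).toEquiv _ _ fun g => ?_
      have h1 := hF' x⁻¹ g
      simp only [inv_inv] at h1
      simp [MonoidAlgebra.of_apply, MonoidAlgebra.single_mul_single, mul_assoc] at h1 ⊢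
      simp [h1]
    | add y z hy hz => rw [mul_add, add_mul, hy, hz]
    | smul r y hy => rw [mul_smul_comm, smul_mul_assoc, hy]
  have key : ∀ S : Submodule (MonoidAlgebra ℂ G) (MonoidAlgebra ℂ G),
      IsSimpleModule (MonoidAlgebra ℂ G) S → ∀ s ∈ S, a * s = 0 := by
    intro S hS s hs
    have hfin : Module.Finite ℂ S := Module.Finite.trans (MonoidAlgebra ℂ G) _
    set V : FDRep ℂ G := FDRep.of (Representation.ofModule' (k := ℂ) (G := G) S) with hVdef
    have hV1 : finrank ℂ (Representation.IntertwiningMap V.ρ V.ρ) = 1 :=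
      finrank_intertwiningMap_ofModule' S
    have hV : IsIrrChar G V.character := ⟨⟨V, rfl⟩, by rw [innerChar_eq_finrank, hV1, Nat.cast_one]⟩
    obtain ⟨c, hc⟩ := exists_sum_smul_eq_smul_id V hV1 (fun g => F g⁻¹) hF'
    have hc0 : c = 0 := by
      have h1 := h _ hV
      rw [innerChar_of_isChar hV.1, mul_eq_zero, inv_eq_zero, or_iff_right (by simp)] at h1
      have h2 := trace_sum_smul V (fun g => F g⁻¹)
      rw [hc, map_smul, smul_eq_mul, LinearMap.trace_one, ← FDRep.char_one,
        ← Equiv.sum_comp (Equiv.inv G)] at h2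
      simp only [Equiv.inv_apply, inv_inv] at h2
      rw [h1, mul_eq_zero, or_iff_left hV.apply_one_ne_zero] at h2
      exact h2
    rw [hc0, zero_smul] at hc
    have h3 : (∑ g, F g⁻¹ • Representation.ofModule' (k := ℂ) (G := G) S g) ⟨s, hs⟩ = 0 :=
      LinearMap.congr_fun hc (⟨s, hs⟩ : S)
    have h4 := congrArg Subtype.val h3
    simp only [LinearMap.sum_apply, LinearMap.smul_apply, Representation.ofModule'_apply,
      AddSubmonoidClass.coe_finsetSum, ZeroMemClass.coe_zero] at h4
    rw [ha, Finset.sum_mul, ← h4]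
    refine Finset.sum_congr rfl fun g _ => ?_
    change _ = F g⁻¹ • (MonoidAlgebra.single g 1 * s)
    rw [← smul_mul_assoc, MonoidAlgebra.smul_single, smul_eq_mul, mul_one]
  have ha0 : a = 0 := by
    have hle : sSup {m : Submodule (MonoidAlgebra ℂ G) (MonoidAlgebra ℂ G) |
        IsSimpleModule (MonoidAlgebra ℂ G) m} ≤
        LinearMap.ker (LinearMap.toSpanSingleton (MonoidAlgebra ℂ G) (MonoidAlgebra ℂ G) a) := by
      refine sSup_le fun S hS s hs => ?_
      rw [LinearMap.mem_ker, LinearMap.toSpanSingleton_apply, smul_eq_mul, ← hcomm, key S hS s hs]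
    rw [IsSemisimpleModule.sSup_simples_eq_top] at hle
    simpa using hle (Submodule.mem_top (x := 1))
  funext g
  have := congrArg (fun b : MonoidAlgebra ℂ G => b.coeff g⁻¹) ha0
  simpa [ha, Finsupp.single_apply] using this

theorem innerChar_sum_smul_left {ι : Type*} (s : Finset ι) (c : ι → ℂ) (α : ι → G → ℂ)
    (β : G → ℂ) :
    innerChar G (fun g => ∑ i ∈ s, c i * α i g) β = ∑ i ∈ s, c i * innerChar G (α i) β := by
  simp only [innerChar, Finset.sum_mul, Finset.mul_sum]
  rw [Finset.sum_comm]
  exact Finset.sum_congr rfl fun i _ => Finset.sum_congr rfl fun g _ => by ring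

theorem innerChar_sub_left (α β γ : G → ℂ) :
    innerChar G (α - β) γ = innerChar G α γ - innerChar G β γ := by
  simp [innerChar, sub_mul, Finset.sum_sub_distrib, mul_sub]

theorem IsIrrChar.innerChar_eq_ite {χ ψ : G → ℂ} (hχ : IsIrrChar G χ) (hψ : IsIrrChar G ψ) :
    innerChar G χ ψ = if χ = ψ then 1 else 0 := by
  split_ifs with h
  · rw [← h, hχ.2]
  · exact hχ.innerChar_eq_zero_s12 hψ h

variable (G) in
/-- The irreducible complex characters of `G`. -/
abbrev IrrChar : Type := {χ : G → ℂ // IsIrrChar G χ}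

theorem IrrChar.linearIndependent :
    LinearIndependent ℂ (Subtype.val : IrrChar G → G → ℂ) := by
  rw [linearIndependent_iff']
  intro s c h j hj
  have h1 := innerChar_sum_smul_left s c (fun χ => χ.1) j.1
  have h2 : (fun g => ∑ i ∈ s, c i * i.1 g) = 0 := by
    rw [← h]
    ext g
    simp
  rw [h2] at h1
  simp only [fun i : IrrChar G => i.2.innerChar_eq_ite j.2, ← Subtype.ext_iff, mul_ite, mul_one,
    mul_zero, Finset.sum_ite_eq', hj, if_true] at h1
  rw [← h1]
  simp [innerChar]

instance : Finite (IrrChar G) := IrrChar.linearIndependent.finite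

noncomputable instance : Fintype (IrrChar G) := Fintype.ofFinite _

theorem eq_sum_innerChar_mul (F : G → ℂ) (hF : ∀ x g, F (x * g * x⁻¹) = F g) (g : G) :
    F g = ∑ χ : IrrChar G, innerChar G F χ.1 * χ.1 g := by
  have h := eq_zero_of_forall_innerChar_eq_zero
    (F - fun g => ∑ χ : IrrChar G, innerChar G F χ.1 * χ.1 g)
    (fun x g => by simp [hF, fun χ : IrrChar G => χ.2.1.apply_conj x g]) ?_
  · exact sub_eq_zero.1 (congrFun h g)
  · intro ψ hψ
    rw [innerChar_sub_left, innerChar_sum_smul_left]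
    simp only [fun i : IrrChar G => i.2.innerChar_eq_ite hψ]
    rw [Finset.sum_eq_single ⟨ψ, hψ⟩ (fun b _ hb => by
      rw [if_neg (fun h => hb (Subtype.ext h)), mul_zero]) (by simp)]
    simp

theorem IsIrrChar.comp_mulEquiv_s12 {K : Type} [Group K] [Fintype K] {χ : G → ℂ}
    (hχ : IsIrrChar G χ) (e : K ≃* G) : IsIrrChar K fun k => χ (e k) := by
  refine ⟨hχ.1.comp e.toMonoidHom, ?_⟩
  rw [← hχ.2, innerChar, innerChar, Fintype.card_congr e.toEquiv]
  congr 1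
  exact Fintype.sum_equiv e.toEquiv _ _ fun _ => rfl

/-- The permutation action on irreducible characters induced by an action by automorphisms. -/
noncomputable def irrCharPerm {A : Type} [Group A] (ρ : A →* MulAut G) :
    A →* Equiv.Perm (IrrChar G) :=
  let : MulAction A (IrrChar G) :=
    { smul := fun a χ => ⟨fun g => χ.1 (ρ a⁻¹ g), χ.2.comp_mulEquiv_s12 (ρ a⁻¹)⟩
      one_smul := fun χ => Subtype.ext (funext fun g => by
        change χ.1 (ρ 1⁻¹ g) = _
        simp)
      mul_smul := fun a b χ => Subtype.ext (funext fun g => by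
        change χ.1 (ρ (a * b)⁻¹ g) = χ.1 (ρ b⁻¹ (ρ a⁻¹ g))
        rw [mul_inv_rev, map_mul, MulAut.mul_apply]) }
  MulAction.toPermHom A (IrrChar G)

theorem irrCharPerm_apply {A : Type} [Group A] (ρ : A →* MulAut G) (a : A) (χ : IrrChar G)
    (g : G) : (irrCharPerm ρ a χ).1 g = χ.1 (ρ a⁻¹ g) := rfl

theorem irrCharPerm_apply_eq_self_iff {A : Type} [Group A] (ρ : A →* MulAut G) (χ : IrrChar G) :
    (∀ a, irrCharPerm ρ a χ = χ) ↔ ∀ a g, χ.1 (ρ a g) = χ.1 g := by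
  refine ⟨fun h a g => ?_, fun h a => Subtype.ext (funext fun g => h a⁻¹ g)⟩
  have := congrFun (congrArg Subtype.val (h a⁻¹)) g
  rwa [irrCharPerm_apply, inv_inv] at this

end Characters

section Congruences

/-- The multiples of `p` in the ring of algebraic integers. -/
noncomputable def integralMultiples (p : ℕ) : AddSubgroup ℂ :=
  (integralClosure ℤ ℂ).toSubring.toAddSubgroup.map (AddMonoidHom.mulLeft (p : ℂ))

theorem mem_integralMultiples {p : ℕ} {x : ℂ} :
    x ∈ integralMultiples p ↔ ∃ z, IsIntegral ℤ z ∧ p * z = x :=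
  Iff.rfl

theorem mul_mem_integralMultiples {p : ℕ} {x y : ℂ} (hx : x ∈ integralMultiples p)
    (hy : IsIntegral ℤ y) : x * y ∈ integralMultiples p := by
  obtain ⟨z, hz, rfl⟩ := mem_integralMultiples.1 hx
  exact mem_integralMultiples.2 ⟨z * y, hz.mul hy, by ring⟩

theorem intCast_mem_integralMultiples {p : ℕ} (hp : p ≠ 0) {n : ℤ} :
    (n : ℂ) ∈ integralMultiples p ↔ (p : ℤ) ∣ n := by
  rw [mem_integralMultiples]
  constructor
  · rintro ⟨z, hz, h⟩
    have hp' : (p : ℂ) ≠ 0 := by exact_mod_cast hp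
    have hq : z = algebraMap ℚ ℂ (n / p) := by
      rw [eq_ratCast]
      push_cast
      rw [← h]
      field_simp
    rw [hq, isIntegral_algebraMap_iff (algebraMap ℚ ℂ).injective] at hz
    obtain ⟨k, hk⟩ := IsIntegrallyClosed.isIntegral_iff.1 hz
    refine ⟨k, ?_⟩
    have : (p : ℚ) ≠ 0 := by exact_mod_cast hp
    rw [eq_intCast, eq_div_iff this] at hk
    exact_mod_cast (by rw [← hk, mul_comm] : (n : ℚ) = p * k)
  · rintro ⟨k, rfl⟩
    exact ⟨k, by simpa using isIntegral_algebraMap (R := ℤ) (A := ℂ) (x := k), by push_cast; rfl⟩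

theorem natCast_mem_integralMultiples {p : ℕ} (hp : p ≠ 0) {n : ℕ} :
    (n : ℂ) ∈ integralMultiples p ↔ p ∣ n := by
  have := intCast_mem_integralMultiples hp (n := n)
  rwa [Int.cast_natCast, Int.natCast_dvd_natCast] at this

/-- Modulo `p`, an invariant sum over a set acted on by a `p`-group reduces to the fixed points. -/
theorem IsPGroup.sum_sub_sum_fixed_mem {A X : Type*} [Group A] [Fintype X] {p : ℕ}
    (hp : p.Prime) (hA : IsPGroup p A) (act : A →* Equiv.Perm X) (φ : X → ℂ)
    (hint : ∀ x, IsIntegral ℤ (φ x)) (hinv : ∀ a x, φ (act a x) = φ x) :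
    ∑ x, φ x - ∑ x with ∀ a, act a x = x, φ x ∈ integralMultiples p := by
  have : Fact p.Prime := ⟨hp⟩
  have hmaps : ∀ s : Finset X, ∑ x ∈ s, φ x =
      ∑ v ∈ Finset.univ.image φ, ∑ x ∈ s with φ x = v, φ x := fun s =>
    (Finset.sum_fiberwise_of_maps_to
      (fun x _ => Finset.mem_image_of_mem φ (Finset.mem_univ x)) φ).symm
  have hcard : ∀ s : Finset X, ∀ v, ∑ x ∈ s with φ x = v, φ x =
      (Finset.card {x ∈ s | φ x = v} : ℂ) * v := fun s v => by
    rw [Finset.sum_congr rfl (fun x hx => (Finset.mem_filter.1 hx).2), Finset.sum_const,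
      nsmul_eq_mul]
  rw [hmaps, hmaps, ← Finset.sum_sub_distrib]
  refine AddSubgroup.sum_mem _ fun v hv => ?_
  obtain ⟨x₀, -, hx₀⟩ := Finset.mem_image.1 hv
  rw [hcard, hcard, ← sub_mul]
  refine mul_mem_integralMultiples ?_ (hx₀ ▸ hint x₀)
  let : MulAction A {x // φ x = v} :=
    { smul := fun a x => ⟨act a x, (hinv a x).trans x.2⟩
      one_smul := fun x => Subtype.ext (by
        change act 1 x.1 = x.1
        simp)
      mul_smul := fun a b x => Subtype.ext (by
        change act (a * b) x.1 = act a (act b x.1)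
        simp) }
  have hmod := hA.card_modEq_card_fixedPoints {x // φ x = v}
  have h1 : Nat.card {x // φ x = v} = Finset.card {x | φ x = v} := by
    rw [Nat.card_eq_fintype_card, Fintype.card_subtype]
  have h2 : Nat.card (MulAction.fixedPoints A {x // φ x = v}) =
      Finset.card {x ∈ {x | ∀ a, act a x = x} | φ x = v} := by
    rw [Finset.filter_filter, ← Fintype.card_subtype, ← Nat.card_eq_fintype_card]
    refine Nat.card_congr
      { toFun := fun x => ⟨x.1.1, fun a => congrArg Subtype.val (x.2 a), x.1.2⟩
        invFun := fun x => ⟨⟨x.1, x.2.2⟩, fun a => Subtype.ext (x.2.1 a)⟩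
        left_inv := fun _ => rfl
        right_inv := fun _ => rfl }
  rw [h1, h2] at hmod
  have h3 := (intCast_mem_integralMultiples hp.ne_zero).2 (Nat.modEq_iff_dvd.1 hmod.symm)
  simpa using h3

end Congruences

section Glauberman

variable {G K A : Type} [Group G] [Fintype G] [Group K] [Fintype K] [Group A] {p : ℕ}
  {ρ : A →* MulAut G} {i : K →* G}

/-- The homomorphism `i` identifies `K` with the subgroup of fixed points of `A` acting on `G`. -/
structure IsFixedPoints (ρ : A →* MulAut G) (i : K →* G) : Prop where
  injective : Function.Injective i
  exists_iff : ∀ g, (∃ c, i c = g) ↔ ∀ a, ρ a g = g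

/-- The irreducible character `τ` of the fixed points is a Glauberman correspondent of `θ`. -/
def IsGlauberman (p : ℕ) (i : K →* G) (θ : G → ℂ) (τ : K → ℂ) : Prop :=
  IsIrrChar K τ ∧ ∃ m : ℕ, innerChar K (fun c => θ (i c)) τ = m ∧ ¬ p ∣ m

theorem innerChar_comp_natCast {χ : G → ℂ} {τ : K → ℂ} (hχ : IsChar G χ) (hτ : IsChar K τ)
    (i : K →* G) : ∃ m : ℕ, innerChar K (fun c => χ (i c)) τ = m :=
  (hχ.comp i).exists_innerChar_eq_natCast hτ

theorem IsChar.card_mul_innerChar {α β : G → ℂ} (hβ : IsChar G β) :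
    Fintype.card G * innerChar G α β = ∑ g, α g * β g⁻¹ := by
  rw [innerChar_of_isChar hβ, mul_inv_cancel_left₀ (by simp)]

theorem IsFixedPoints.sum_sub_sum_mem (h : IsFixedPoints ρ i) (hp : p.Prime) (hA : IsPGroup p A)
    (φ : G → ℂ) (hint : ∀ g, IsIntegral ℤ (φ g)) (hinv : ∀ a g, φ (ρ a g) = φ g) :
    ∑ g, φ g - ∑ c, φ (i c) ∈ integralMultiples p := by
  have h1 := hA.sum_sub_sum_fixed_mem hp ((MulAut.toPerm G).comp ρ) φ hint hinv
  convert h1 using 2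
  refine Finset.sum_bij (fun c _ => i c) (fun c _ => ?_) (fun c _ d _ hcd => h.injective hcd)
    (fun g hg => ?_) (fun _ _ => rfl)
  · exact Finset.mem_filter.2 ⟨Finset.mem_univ _, (h.exists_iff _).1 ⟨c, rfl⟩⟩
  · obtain ⟨c, hc⟩ := (h.exists_iff g).2 (Finset.mem_filter.1 hg).2
    exact ⟨c, Finset.mem_univ _, hc⟩

theorem IsFixedPoints.not_dvd_card (h : IsFixedPoints ρ i) (hpG : ¬ p ∣ Fintype.card G) :
    ¬ p ∣ Fintype.card K := by
  refine fun hK => hpG (hK.trans ?_)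
  rw [← Nat.card_eq_fintype_card, ← Nat.card_eq_fintype_card]
  exact Subgroup.card_dvd_of_injective i h.injective

/-- Restrictions of distinct invariant irreducible characters to the fixed points have no common
constituent with multiplicities prime to `p`. -/
theorem IsFixedPoints.dvd_mul_of_ne (h : IsFixedPoints ρ i) (hp : p.Prime) (hA : IsPGroup p A)
    (hpG : ¬ p ∣ Fintype.card G) {χ ψ : G → ℂ} {τ : K → ℂ} (hχ : IsIrrChar G χ)
    (hψ : IsIrrChar G ψ) (hτ : IsIrrChar K τ) (hχinv : ∀ a g, χ (ρ a g) = χ g)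
    (hψinv : ∀ a g, ψ (ρ a g) = ψ g) (hne : χ ≠ ψ) {m n : ℕ}
    (hm : innerChar K (fun c => χ (i c)) τ = m) (hn : innerChar K (fun c => ψ (i c)) τ = n) :
    p ∣ m * n := by
  have hconv : ∀ c, ∑ d, χ (i d)⁻¹ * ψ (i d * i c) ∈ integralMultiples p := by
    intro c
    have h1 := h.sum_sub_sum_mem hp hA (fun g => χ g⁻¹ * ψ (g * i c))
      (fun g => (hχ.1.isIntegral _).mul (hψ.1.isIntegral _)) (fun a g => by
        have hc := (h.exists_iff _).1 ⟨c, rfl⟩ a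
        rw [← map_inv, hχinv, ← hψinv a (g * i c), map_mul, hc])
    have h2 := hψ.one_mul_sum_apply_mul (fun g => χ g⁻¹)
      (fun x g => by rw [← hχ.1.apply_conj x g⁻¹]; simp [mul_assoc]) (i c)
    have h3 : ∑ g, χ g⁻¹ * ψ g = 0 := by
      have := hχ.1.card_mul_innerChar (α := ψ)
      rw [hψ.innerChar_eq_zero_s12 hχ hne.symm, mul_zero] at this
      simp_rw [mul_comm (χ _), ← this]
    rw [h3, zero_mul, mul_eq_zero, or_iff_right hψ.apply_one_ne_zero] at h2
    rw [h2, zero_sub, neg_mem_iff] at h1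
    exact h1
  have hsum : τ 1 * ∑ c, (∑ d, χ (i d)⁻¹ * ψ (i d * i c)) * τ c⁻¹ =
      ((Fintype.card K ^ 2 * (m * n) : ℕ) : ℂ) := by
    have h4 : ∀ d, τ 1 * ∑ c, ψ (i d * i c) * τ c⁻¹ = Fintype.card K * n * τ d := by
      intro d
      have h5 := hτ.one_mul_sum_apply_mul (fun c => ψ (i c)⁻¹)
        (fun x g => by rw [← hψ.1.apply_conj (i x) (i g)⁻¹]; simp [mul_assoc]) d
      rw [← hn, hτ.1.card_mul_innerChar, ← Equiv.sum_comp (Equiv.inv K) (fun c => ψ (i c) * τ c⁻¹)]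
      simp only [Equiv.inv_apply, inv_inv, map_inv]
      rw [← h5]
      congr 1
      refine Fintype.sum_equiv ((Equiv.mulLeft d).trans (Equiv.inv K)) _ _ fun c => ?_
      simp [mul_assoc]
    calc _ = ∑ d, χ (i d)⁻¹ * (τ 1 * ∑ c, ψ (i d * i c) * τ c⁻¹) := by
          simp only [Finset.mul_sum, Finset.sum_mul]
          rw [Finset.sum_comm]
          exact Finset.sum_congr rfl fun d _ => Finset.sum_congr rfl fun c _ => by ring
      _ = Fintype.card K * n * ∑ d, χ (i d)⁻¹ * τ d := by
          rw [Finset.mul_sum]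
          exact Finset.sum_congr rfl fun d _ => by rw [h4]; ring
      _ = Fintype.card K * n * (Fintype.card K * m) := by
          rw [← hm, hτ.1.card_mul_innerChar,
            ← Equiv.sum_comp (Equiv.inv K) (fun c => χ (i c) * τ c⁻¹)]
          simp
      _ = _ := by push_cast; ring
  have hmem : ((Fintype.card K ^ 2 * (m * n) : ℕ) : ℂ) ∈ integralMultiples p := by
    rw [← hsum, mul_comm]
    exact mul_mem_integralMultiples (AddSubgroup.sum_mem _ fun c _ =>
      mul_mem_integralMultiples (hconv c) (hτ.1.isIntegral _)) (hτ.1.isIntegral _)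
  refine ((hp.dvd_mul.1 ((natCast_mem_integralMultiples hp.ne_zero).1 hmem)).resolve_left ?_)
  exact fun h' => h.not_dvd_card hpG (hp.dvd_of_dvd_pow h')

theorem IsFixedPoints.exists_isGlauberman (h : IsFixedPoints ρ i) (hp : p.Prime) (hA : IsPGroup p A)
    (hpG : ¬ p ∣ Fintype.card G) {χ : G → ℂ} (hχ : IsIrrChar G χ)
    (hχinv : ∀ a g, χ (ρ a g) = χ g) :
    ∃ τ, IsGlauberman p i χ τ := by
  by_contra! hcon
  have h1 := h.sum_sub_sum_mem hp hA (fun g => χ g * χ g⁻¹)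
    (fun g => (hχ.1.isIntegral _).mul (hχ.1.isIntegral _)) (fun a g => by
      rw [← map_inv, hχinv, hχinv])
  rw [← hχ.1.card_mul_innerChar, hχ.2, mul_one] at h1
  have h2 : ∑ c, χ (i c) * χ (i c)⁻¹ ∈ integralMultiples p := by
    refine AddSubgroup.sum_mem _ fun c _ => mul_mem_integralMultiples ?_ (hχ.1.isIntegral _)
    rw [eq_sum_innerChar_mul (fun c => χ (i c)) (fun x g => by
      simp [hχ.1.apply_conj]) c]
    refine AddSubgroup.sum_mem _ fun τ _ => mul_mem_integralMultiples ?_ (τ.2.1.isIntegral _)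
    obtain ⟨m, hm⟩ := innerChar_comp_natCast hχ.1 τ.2.1 i
    rw [hm, natCast_mem_integralMultiples hp.ne_zero]
    exact not_not.1 fun hpm => hcon τ.1 ⟨τ.2, m, hm, hpm⟩
  have h3 := add_mem h1 h2
  rw [sub_add_cancel, natCast_mem_integralMultiples hp.ne_zero] at h3
  exact hpG h3

/-- Modulo `p`, the multiplicities of irreducible characters of the fixed points in invariant
irreducible characters of `G` have orthonormal columns. -/
theorem IsFixedPoints.card_mul_sum_sub_mem (h : IsFixedPoints ρ i) (hp : p.Prime)
    (hA : IsPGroup p A) {τ σ : K → ℂ} (hτ : IsIrrChar K τ) (hσ : IsIrrChar K σ) :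
    (Fintype.card K : ℂ) ^ 2 * (∑ χ : IrrChar G with ∀ a, irrCharPerm ρ a χ = χ,
      innerChar K (fun c => χ.1 (i c)) τ * innerChar K (fun c => χ.1 (i c)) σ) -
      (Fintype.card K : ℂ) ^ 2 * innerChar K τ σ ∈ integralMultiples p := by
  set T : G → ℂ := Function.extend (⇑i) τ (0 : G → ℂ)
  have hTi : ∀ c, T (i c) = τ c := fun c => h.injective.extend_apply τ (0 : G → ℂ) c
  have hT0 : ∀ g, (¬ ∃ c, i c = g) → T g = 0 := fun g hg =>
    Function.extend_apply' τ (0 : G → ℂ) g hg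
  have hTinv : ∀ a g, T (ρ a g) = T g := by
    intro a g
    by_cases hg : ∃ c, i c = g
    · rw [(h.exists_iff g).1 hg a]
    · rw [hT0 g hg, hT0]
      rw [h.exists_iff] at hg ⊢
      intro hag
      have h1 : ρ a g = g := (ρ a).injective (hag a)
      rw [h1] at hag
      exact hg hag
  have hTint : ∀ g, IsIntegral ℤ (T g) := by
    intro g
    by_cases hg : ∃ c, i c = g
    · obtain ⟨c, rfl⟩ := hg
      rw [hTi]
      exact hτ.1.isIntegral c
    · rw [hT0 g hg]
      exact isIntegral_zero
  set F : G → ℂ := fun g => ∑ x, T (x * g * x⁻¹) with hF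
  have hFconj : ∀ x g, F (x * g * x⁻¹) = F g := fun x g =>
    Fintype.sum_equiv (Equiv.mulRight x) _ _ fun y => by simp [mul_assoc]
  have hFinner : ∀ χ, IsChar G χ →
      innerChar G F χ = Fintype.card K * innerChar K (fun c => χ (i c)) τ := by
    intro χ hχ
    rw [hτ.1.card_mul_innerChar, innerChar_of_isChar hχ, inv_mul_eq_iff_eq_mul₀ (by simp)]
    simp only [hF, Finset.sum_mul]
    rw [Finset.sum_comm]
    have h1 : ∀ x, ∑ g, T (x * g * x⁻¹) * χ g⁻¹ = ∑ g, T g * χ g⁻¹ := fun x =>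
      Fintype.sum_equiv (MulAut.conj x).toEquiv _ _ fun g => by
        rw [← hχ.apply_conj x g⁻¹]
        simp [mul_assoc]
    have h2 : ∑ g, T g * χ g⁻¹ = ∑ c, χ (i c) * τ c⁻¹ := by
      rw [← Equiv.sum_comp (Equiv.inv K)]
      simp only [Equiv.inv_apply, inv_inv, map_inv]
      refine (Finset.sum_of_injOn i h.injective.injOn (by simp) (fun g _ hg => ?_)
        (fun c _ => ?_)).symm
      · rw [hT0 g (by simpa using hg), zero_mul]
      · rw [hTi, mul_comm]
    simp [h1, h2]
  have hmain : ∀ c, Fintype.card K * ∑ χ : IrrChar G with ∀ a, irrCharPerm ρ a χ = χ,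
      innerChar K (fun c => χ.1 (i c)) τ * χ.1 (i c) - Fintype.card K * τ c ∈
        integralMultiples p := by
    intro c
    have hc : ∀ a, ρ a (i c) = i c := (h.exists_iff _).1 ⟨c, rfl⟩
    have h1 := h.sum_sub_sum_mem hp hA (fun x => T (x * i c * x⁻¹)) (fun _ => hTint _)
      (fun a x => by
        rw [← hTinv a (x * i c * x⁻¹)]
        simp [hc])
    have h2 : ∑ d, T (i d * i c * (i d)⁻¹) = Fintype.card K * τ c := by
      simp_rw [← map_inv, ← map_mul, hTi, hτ.1.apply_conj]
      simp
    have h3 := hA.sum_sub_sum_fixed_mem hp (irrCharPerm ρ)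
      (fun χ => Fintype.card K * (innerChar K (fun c => χ.1 (i c)) τ * χ.1 (i c)))
      (fun χ => by
        obtain ⟨m, hm⟩ := innerChar_comp_natCast χ.2.1 hτ.1 i
        rw [hm]
        exact (isIntegral_natCast _).mul ((isIntegral_natCast _).mul (χ.2.1.isIntegral _)))
      (fun a χ => by
        have hic : ∀ d, (irrCharPerm ρ a χ).1 (i d) = χ.1 (i d) := fun d => by
          rw [irrCharPerm_apply, (h.exists_iff _).1 ⟨d, rfl⟩]
        simp only [hic])
    have h4 : ∑ x, T (x * i c * x⁻¹) = ∑ χ : IrrChar G,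
        Fintype.card K * (innerChar K (fun c => χ.1 (i c)) τ * χ.1 (i c)) := by
      refine (eq_sum_innerChar_mul F hFconj (i c)).trans ?_
      exact Finset.sum_congr rfl fun χ _ => by rw [hFinner _ χ.2.1, mul_assoc]
    rw [h2, h4] at h1
    rw [Finset.mul_sum]
    simpa using sub_mem h1 h3
  have hsum := AddSubgroup.sum_mem _ fun c (_ : c ∈ Finset.univ) =>
    mul_mem_integralMultiples (hmain c) (hσ.1.isIntegral c⁻¹)
  simp only [sub_mul, Finset.sum_sub_distrib, mul_assoc (Fintype.card K : ℂ),
    ← Finset.mul_sum, ← hσ.1.card_mul_innerChar] at hsum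
  rwa [innerChar_sum_smul_left _ _ fun (χ : IrrChar G) c => χ.1 (i c), ← mul_assoc, ← mul_assoc,
    ← pow_two] at hsum

theorem IsFixedPoints.exists_isGlauberman_of_isIrrChar (h : IsFixedPoints ρ i) (hp : p.Prime)
    (hA : IsPGroup p A) (hpG : ¬ p ∣ Fintype.card G) {τ : K → ℂ} (hτ : IsIrrChar K τ) :
    ∃ θ, IsIrrChar G θ ∧ (∀ a g, θ (ρ a g) = θ g) ∧ IsGlauberman p i θ τ := by
  by_contra! hcon
  have h1 := h.card_mul_sum_sub_mem hp hA hτ hτ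
  have h2 : (Fintype.card K : ℂ) ^ 2 * (∑ χ : IrrChar G with ∀ a, irrCharPerm ρ a χ = χ,
      innerChar K (fun c => χ.1 (i c)) τ * innerChar K (fun c => χ.1 (i c)) τ) ∈
      integralMultiples p := by
    rw [mul_comm]
    refine mul_mem_integralMultiples (AddSubgroup.sum_mem _ fun χ hχ => ?_)
      ((isIntegral_natCast _).pow 2)
    have hinv := (irrCharPerm_apply_eq_self_iff ρ χ).1 (Finset.mem_filter.1 hχ).2
    obtain ⟨m, hm⟩ := innerChar_comp_natCast χ.2.1 hτ.1 i
    rw [hm, ← Nat.cast_mul, natCast_mem_integralMultiples hp.ne_zero]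
    exact (not_not.1 fun hpm => hcon χ.1 χ.2 hinv ⟨hτ, m, hm, hpm⟩).mul_right m
  have h3 := sub_mem h2 h1
  rw [sub_sub_cancel, hτ.2, mul_one, ← Nat.cast_pow, natCast_mem_integralMultiples hp.ne_zero] at h3
  exact h.not_dvd_card hpG (hp.dvd_of_dvd_pow h3)

theorem IsFixedPoints.eq_of_isGlauberman (h : IsFixedPoints ρ i) (hp : p.Prime)
    (hA : IsPGroup p A) (hpG : ¬ p ∣ Fintype.card G) {θ₁ θ₂ : G → ℂ} {τ : K → ℂ}
    (h₁ : IsIrrChar G θ₁) (h₁inv : ∀ a g, θ₁ (ρ a g) = θ₁ g) (h₂ : IsIrrChar G θ₂)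
    (h₂inv : ∀ a g, θ₂ (ρ a g) = θ₂ g) (h₁τ : IsGlauberman p i θ₁ τ)
    (h₂τ : IsGlauberman p i θ₂ τ) : θ₁ = θ₂ := by
  by_contra hne
  obtain ⟨hτ, m, hm, hpm⟩ := h₁τ
  obtain ⟨-, n, hn, hpn⟩ := h₂τ
  exact (hp.dvd_mul.1 (h.dvd_mul_of_ne hp hA hpG h₁ h₂ hτ h₁inv h₂inv hne hm hn)).elim hpm hpn

theorem IsFixedPoints.isGlauberman_unique (h : IsFixedPoints ρ i) (hp : p.Prime)
    (hA : IsPGroup p A) (hpG : ¬ p ∣ Fintype.card G) {θ : G → ℂ} {τ σ : K → ℂ}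
    (hθ : IsIrrChar G θ) (hθinv : ∀ a g, θ (ρ a g) = θ g) (hθτ : IsGlauberman p i θ τ)
    (hθσ : IsGlauberman p i θ σ) : τ = σ := by
  by_contra hne
  obtain ⟨hτ, m, hm, hpm⟩ := hθτ
  obtain ⟨hσ, n, hn, hpn⟩ := hθσ
  have h1 := h.card_mul_sum_sub_mem hp hA hτ hσ
  rw [hτ.innerChar_eq_zero_s12 hσ hne, mul_zero, sub_zero, Finset.mul_sum,
    ← Finset.add_sum_erase _ _ (Finset.mem_filter.2 ⟨Finset.mem_univ ⟨θ, hθ⟩,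
      (irrCharPerm_apply_eq_self_iff ρ ⟨θ, hθ⟩).2 hθinv⟩), hm, hn] at h1
  have h2 : ∑ χ ∈ Finset.erase {χ : IrrChar G | ∀ a, irrCharPerm ρ a χ = χ} ⟨θ, hθ⟩,
      (Fintype.card K : ℂ) ^ 2 * (innerChar K (fun c => χ.1 (i c)) τ *
        innerChar K (fun c => χ.1 (i c)) σ) ∈ integralMultiples p := by
    refine AddSubgroup.sum_mem _ fun χ hχ => ?_
    obtain ⟨hχne, hχ⟩ := Finset.mem_erase.1 hχ
    have hinv := (irrCharPerm_apply_eq_self_iff ρ χ).1 (Finset.mem_filter.1 hχ).2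
    obtain ⟨k, hk⟩ := innerChar_comp_natCast χ.2.1 hτ.1 i
    obtain ⟨l, hl⟩ := innerChar_comp_natCast χ.2.1 hσ.1 i
    rw [hk, hl, ← Nat.cast_pow, ← Nat.cast_mul, ← Nat.cast_mul,
      natCast_mem_integralMultiples hp.ne_zero]
    refine Dvd.dvd.mul_left (Dvd.dvd.mul_right (not_not.1 fun hpk => hχne ?_) l) _
    exact Subtype.ext (h.eq_of_isGlauberman hp hA hpG χ.2 hinv hθ hθinv ⟨hτ, k, hk, hpk⟩
      ⟨hτ, m, hm, hpm⟩)
  have h3 := sub_mem h1 h2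
  rw [add_sub_cancel_right, ← Nat.cast_pow, ← Nat.cast_mul, ← Nat.cast_mul,
    natCast_mem_integralMultiples hp.ne_zero] at h3
  exact (hp.dvd_mul.1 h3).elim (fun h' => h.not_dvd_card hpG (hp.dvd_of_dvd_pow h'))
    fun h' => (hp.dvd_mul.1 h').elim hpm hpn

/-- Two groups with the same fixed points of `A` have matching invariant irreducible characters. -/
theorem IsFixedPoints.exists_correspondence {L : Type} [Group L] [Fintype L] {ρ' : A →* MulAut L}
    {j : K →* L} (h : IsFixedPoints ρ i) (h' : IsFixedPoints ρ' j) (hp : p.Prime)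
    (hA : IsPGroup p A) (hpG : ¬ p ∣ Fintype.card G) (hpL : ¬ p ∣ Fintype.card L) {θ : G → ℂ}
    (hθ : IsIrrChar G θ) (hθinv : ∀ a g, θ (ρ a g) = θ g) :
    ∃ ψ, IsIrrChar L ψ ∧ (∀ a g, ψ (ρ' a g) = ψ g) ∧
      ∀ τ, IsGlauberman p i θ τ ↔ IsGlauberman p j ψ τ := by
  obtain ⟨σ, hσ⟩ := h.exists_isGlauberman hp hA hpG hθ hθinv
  obtain ⟨ψ, hψ, hψinv, hψσ⟩ := h'.exists_isGlauberman_of_isIrrChar hp hA hpL hσ.1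
  refine ⟨ψ, hψ, hψinv, fun τ => ⟨fun hτ => ?_, fun hτ => ?_⟩⟩
  · rwa [h.isGlauberman_unique hp hA hpG hθ hθinv hτ hσ]
  · rwa [h'.isGlauberman_unique hp hA hpL hψ hψinv hτ hψσ]

end Glauberman

theorem stmt_12 {G A : Type} [Group G] [Fintype G] [Group A] [Fintype A]
    (p : ℕ) (hp : p.Prime) (hA : IsPGroup p A) (hpG : ¬ p ∣ Fintype.card G)
    (ρ : A →* MulAut G)
    (C : Subgroup G) (hC : ∀ g : G, g ∈ C ↔ ∀ a : A, ρ a g = g)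
    (H : Subgroup G) (hCH : C ≤ H) (hHinv : ∀ a : A, ∀ g ∈ H, ρ a g ∈ H) :
    ∃ f : (G → ℂ) → (↥H → ℂ),
      (∀ θ : G → ℂ, IsIrrChar G θ → (∀ a : A, ∀ g : G, θ (ρ a g) = θ g) →
        (IsIrrChar ↥H (f θ) ∧
          ∀ a : A, ∀ h : ↥H, f θ ⟨ρ a ↑h, hHinv a ↑h h.2⟩ = f θ h)) ∧
      (∀ θ₁ θ₂ : G → ℂ,
        IsIrrChar G θ₁ → (∀ a : A, ∀ g : G, θ₁ (ρ a g) = θ₁ g) →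
        IsIrrChar G θ₂ → (∀ a : A, ∀ g : G, θ₂ (ρ a g) = θ₂ g) →
        f θ₁ = f θ₂ → θ₁ = θ₂) ∧
      (∀ ψ : ↥H → ℂ, IsIrrChar ↥H ψ →
        (∀ a : A, ∀ h : ↥H, ψ ⟨ρ a ↑h, hHinv a ↑h h.2⟩ = ψ h) →
        ∃ θ : G → ℂ, IsIrrChar G θ ∧ (∀ a : A, ∀ g : G, θ (ρ a g) = θ g) ∧ f θ = ψ) ∧
      (∀ θ : G → ℂ, IsIrrChar G θ → (∀ a : A, ∀ g : G, θ (ρ a g) = θ g) →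
        ∀ τ : ↥C → ℂ,
          (IsIrrChar ↥C τ ∧
            ∃ m : ℕ, innerChar ↥C (fun c => θ ↑c) τ = m ∧ ¬ p ∣ m) ↔
          (IsIrrChar ↥C τ ∧
            ∃ m : ℕ, innerChar ↥C (fun c => f θ ⟨↑c, hCH c.2⟩) τ = m ∧ ¬ p ∣ m)) := by
  let ρH : A →* MulAut H :=
    { toFun := fun a =>
        { toFun := fun x => ⟨ρ a x, hHinv a x x.2⟩
          invFun := fun x => ⟨ρ a⁻¹ x, hHinv a⁻¹ x x.2⟩
          left_inv := fun x => Subtype.ext (by simp)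
          right_inv := fun x => Subtype.ext (by simp)
          map_mul' := fun x y => Subtype.ext (by simp) }
      map_one' := by
        ext x
        simp
      map_mul' := fun a b => by
        ext x
        simp }
  have hfixG : IsFixedPoints ρ C.subtype :=
    ⟨C.subtype_injective, fun g => by rw [← hC]; simp⟩
  have hfixH : IsFixedPoints ρH (Subgroup.inclusion hCH) := by
    refine ⟨Subgroup.inclusion_injective hCH, fun x => ?_⟩
    refine ⟨?_, fun hx => ⟨⟨x, (hC x).2 fun a => congrArg Subtype.val (hx a)⟩, rfl⟩⟩
    rintro ⟨c, rfl⟩ a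
    exact Subtype.ext ((hC c).1 c.2 a)
  have hpH : ¬ p ∣ Fintype.card H := by
    refine fun hd => hpG (hd.trans ?_)
    rw [← Nat.card_eq_fintype_card, ← Nat.card_eq_fintype_card]
    exact H.card_subgroup_dvd_card
  choose! f hf hfinv hfiff using fun (θ : G → ℂ)
    (hθ : IsIrrChar G θ ∧ ∀ a g, θ (ρ a g) = θ g) =>
      hfixG.exists_correspondence hfixH hp hA hpG hpH hθ.1 hθ.2
  refine ⟨f, fun θ hθ hinv => ⟨hf θ ⟨hθ, hinv⟩, hfinv θ ⟨hθ, hinv⟩⟩, ?_, ?_,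
    fun θ hθ hinv => hfiff θ ⟨hθ, hinv⟩⟩
  · intro θ₁ θ₂ h₁ h₁inv h₂ h₂inv heq
    obtain ⟨τ, hτ⟩ := hfixG.exists_isGlauberman hp hA hpG h₁ h₁inv
    refine hfixG.eq_of_isGlauberman hp hA hpG h₁ h₁inv h₂ h₂inv hτ ?_
    rwa [hfiff θ₂ ⟨h₂, h₂inv⟩, ← heq, ← hfiff θ₁ ⟨h₁, h₁inv⟩]
  · intro ψ hψ hψinv
    obtain ⟨τ, hτ⟩ := hfixH.exists_isGlauberman hp hA hpH hψ hψinv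
    obtain ⟨θ, hθ, hinv, hθτ⟩ := hfixG.exists_isGlauberman_of_isIrrChar hp hA hpG hτ.1
    exact ⟨θ, hθ, hinv, hfixH.eq_of_isGlauberman hp hA hpH (hf θ ⟨hθ, hinv⟩)
      (hfinv θ ⟨hθ, hinv⟩) hψ hψinv ((hfiff θ ⟨hθ, hinv⟩ τ).1 hθτ) hτ⟩
end
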